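/- If a contraction T on a Hilbert space H is similar to an isometry V of finite multiplicity, then sup over λ in the open unit disk of the trace norm ‖I - b_λ(T)* b_λ(T)‖_{S₁} is finite. -/

import Mathlib

open scoped InnerProductSpace ComplexConjugate
open ContinuousLinearMap Submodule

/-- The Möbius transform `b_λ(T) = (T - λI)(I - conj(λ)T)⁻¹`. -/
noncomputable def blam {H : Type*} [NormedAddCommGroup H] [InnerProductSpace ℂ H]
    [CompleteSpace H] (T : H →L[ℂ] H) (l : ℂ) : H →L[ℂ] H :=
  (T - l • (1 : H →L[ℂ] H)) * Ring.inverse ((1 : H →L[ℂ] H) - conj l • T)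

section Trace

variable {F H K : Type*} [NormedAddCommGroup F] [InnerProductSpace ℂ F]
  [NormedAddCommGroup H] [InnerProductSpace ℂ H] [CompleteSpace H]
  [NormedAddCommGroup K] [InnerProductSpace ℂ K]

/-- The squared Hilbert–Schmidt norm does not depend on the orthonormal basis. -/
theorem sum_norm_sq_orthonormalBasis_eq [FiniteDimensional ℂ F] {ι κ : Type*} [Fintype ι]
    [Fintype κ] (Y : F →L[ℂ] H) (b : OrthonormalBasis ι ℂ F) (c : OrthonormalBasis κ ℂ F) :
    ∑ i, ‖Y (b i)‖ ^ 2 = ∑ i, ‖Y (c i)‖ ^ 2 := by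
  have : CompleteSpace F := FiniteDimensional.complete ℂ F
  have key (x : F) : ⟪x, ((adjoint Y).comp Y : F →ₗ[ℂ] F) x⟫_ℂ = ((‖Y x‖ ^ 2 : ℝ) : ℂ) := by
    simp [adjoint_inner_right, inner_self_eq_norm_sq_to_K]
  have hb := LinearMap.trace_eq_sum_inner ((adjoint Y).comp Y : F →ₗ[ℂ] F) b
  rw [LinearMap.trace_eq_sum_inner _ c] at hb
  simp only [key] at hb
  exact_mod_cast hb.symm

/-- An orthonormal family indexed by `Fin d` extends to an orthonormal basis. -/
theorem Orthonormal.exists_orthonormalBasis_inl [FiniteDimensional ℂ F] {d r : ℕ}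
    (hr : Module.finrank ℂ F = d + r) {u : Fin d → F} (hu : Orthonormal ℂ u) :
    ∃ b : OrthonormalBasis (Fin d ⊕ Fin r) ℂ F, ∀ i, b (Sum.inl i) = u i := by
  have hu' : Orthonormal ℂ ((Set.range (Sum.inl : Fin d → Fin d ⊕ Fin r)).domRestrict
      (Sum.elim u 0)) := by
    constructor
    · rintro ⟨_, i, rfl⟩
      simpa using hu.1 i
    · rintro ⟨_, i, rfl⟩ ⟨_, j, rfl⟩ hij
      have : i ≠ j := fun h => hij (by simp [h])
      simpa using hu.2 this
  obtain ⟨b, hb⟩ := hu'.exists_orthonormalBasis_extension_of_card_eq (by simp [hr])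
  exact ⟨b, fun i => by simpa using hb _ ⟨i, rfl⟩⟩

/-- Two orthonormal families of the same size in a space of dimension at most `d + m` have
Hilbert–Schmidt sums differing by at most `m * ‖Y‖ ^ 2`. -/
theorem Orthonormal.sum_norm_sq_le_add [FiniteDimensional ℂ F] {d m : ℕ}
    (hm : Module.finrank ℂ F ≤ d + m) (Y : F →L[ℂ] H) {u v : Fin d → F}
    (hu : Orthonormal ℂ u) (hv : Orthonormal ℂ v) :
    ∑ i, ‖Y (u i)‖ ^ 2 ≤ ∑ i, ‖Y (v i)‖ ^ 2 + m * ‖Y‖ ^ 2 := by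
  have hd : d ≤ Module.finrank ℂ F := by
    simpa using hu.linearIndependent.fintype_card_le_finrank
  obtain ⟨r, hr⟩ := Nat.exists_eq_add_of_le hd
  obtain ⟨b, hb⟩ := hu.exists_orthonormalBasis_inl hr
  obtain ⟨c, hc⟩ := hv.exists_orthonormalBasis_inl hr
  have h := sum_norm_sq_orthonormalBasis_eq Y b c
  simp only [Fintype.sum_sum_type, hb, hc] at h
  have h₁ : 0 ≤ ∑ j, ‖Y (b (Sum.inr j))‖ ^ 2 := by positivity
  have h₂ : ∑ j : Fin r, ‖Y (c (Sum.inr j))‖ ^ 2 ≤ r * ‖Y‖ ^ 2 := by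
    refine (Finset.sum_le_card_nsmul _ _ (‖Y‖ ^ 2) fun j _ => ?_).trans (by simp)
    have := Y.le_opNorm (c (Sum.inr j))
    rw [c.orthonormal.1, mul_one] at this
    gcongr
  have h₃ : (r : ℝ) * ‖Y‖ ^ 2 ≤ m * ‖Y‖ ^ 2 := by
    gcongr
    omega
  linarith

/-- If `W` is isometric, `L` and `W L` lie in `L'` and `dim L' ≤ dim L + m`, then the trace of the
compression of `X* X - W* X* X W` to `L` is at most `m * ‖X‖ ^ 2`. -/
theorem sum_norm_sq_sub_norm_sq_le {L L' : Submodule ℂ K} [FiniteDimensional ℂ L']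
    (X : K →L[ℂ] H) (W : K →ₗᵢ[ℂ] K) (hL : L ≤ L') (hW : ∀ x ∈ L, W x ∈ L') {d m : ℕ}
    (hm : Module.finrank ℂ L' ≤ d + m) {u : Fin d → L} (hu : Orthonormal ℂ u) :
    ∑ i, (‖X (u i)‖ ^ 2 - ‖X (W (u i))‖ ^ 2) ≤ m * ‖X‖ ^ 2 := by
  have hu' : Orthonormal ℂ fun i => (⟨u i, hL (u i).2⟩ : L') :=
    ⟨fun i => hu.1 i, fun i j hij => hu.2 hij⟩
  have hv' : Orthonormal ℂ fun i => (⟨W (u i), hW _ (u i).2⟩ : L') :=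
    ⟨fun i => by simpa using hu.1 i, fun i j hij => by simpa using hu.2 hij⟩
  have h := hu'.sum_norm_sq_le_add hm (X.comp L'.subtypeL) hv'
  simp only [ContinuousLinearMap.comp_apply, Submodule.subtypeL_apply] at h
  have h₁ : ‖X.comp L'.subtypeL‖ ≤ ‖X‖ :=
    opNorm_le_bound _ (norm_nonneg _) fun x => by simpa using X.le_opNorm x
  have h₂ : (m : ℝ) * ‖X.comp L'.subtypeL‖ ^ 2 ≤ m * ‖X‖ ^ 2 := by gcongr
  rw [Finset.sum_sub_distrib]
  linarith

/-- The difference of two Hermitian squares is diagonal in a suitable orthonormal basis of a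
finite-dimensional space. -/
theorem exists_orthonormalBasis_norm_sq_sub_norm_sq [FiniteDimensional ℂ F]
    (Y Z : F →L[ℂ] H) :
    ∃ u : OrthonormalBasis (Fin (Module.finrank ℂ F)) ℂ F, ∀ x,
      ‖Y x‖ ^ 2 - ‖Z x‖ ^ 2 =
        ∑ j, (‖Y (u j)‖ ^ 2 - ‖Z (u j)‖ ^ 2) * ‖⟪u j, x⟫_ℂ‖ ^ 2 := by
  have : CompleteSpace F := FiniteDimensional.complete ℂ F
  let S : F →ₗ[ℂ] F := ((adjoint Y).comp Y - (adjoint Z).comp Z : F →L[ℂ] F)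
  have hS : S.IsSymmetric := fun x y => by
    simp [S, inner_sub_left, inner_sub_right, adjoint_inner_right, adjoint_inner_left]
  have hq (x : F) : ⟪x, S x⟫_ℂ = ((‖Y x‖ ^ 2 - ‖Z x‖ ^ 2 : ℝ) : ℂ) := by
    simp [S, adjoint_inner_right, inner_self_eq_norm_sq_to_K]
  let u := hS.eigenvectorBasis rfl
  have hev (j) : ‖Y (u j)‖ ^ 2 - ‖Z (u j)‖ ^ 2 = hS.eigenvalues rfl j := by
    have h := hq (u j)
    rw [hS.apply_eigenvectorBasis, inner_smul_right, inner_self_eq_norm_sq_to_K,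
      u.orthonormal.1] at h
    simp only [RCLike.ofReal_one, one_pow, mul_one] at h
    exact (Complex.ofReal_injective h).symm
  refine ⟨u, fun x => ?_⟩
  have h := hq x
  rw [← u.sum_inner_mul_inner] at h
  have hterm (j) : ⟪x, u j⟫_ℂ * ⟪u j, S x⟫_ℂ =
      (((‖Y (u j)‖ ^ 2 - ‖Z (u j)‖ ^ 2) * ‖⟪u j, x⟫_ℂ‖ ^ 2 : ℝ) : ℂ) := by
    rw [← hS (u j) x, hS.apply_eigenvectorBasis, inner_smul_left, hev,
      ← inner_conj_symm x (u j)]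
    have := Complex.conj_mul' ⟪u j, x⟫_ℂ
    push_cast
    rw [← this]
    simp [u]
    ring
  simp only [hterm] at h
  exact_mod_cast h.symm

variable [CompleteSpace K]

/-- Let `A X = X W` with `A` a contraction and `W` an isometry. If an increasing sequence of
finite-dimensional subspaces `L n` with dense union satisfies `L n + W (L n) ⊆ L' n` and
`dim (L' n) ≤ dim (L n) + m`, then `I - A* A` has trace at most `‖X⁻¹‖ ^ 2 * (m * ‖X‖ ^ 2)`. -/
theorem sum_norm_sq_sub_norm_sq_le_of_similar (A : H →L[ℂ] H) (hA : ∀ x, ‖A x‖ ≤ ‖x‖)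
    (W : K →ₗᵢ[ℂ] K) (X : K →L[ℂ] H) (Xinv : H →L[ℂ] K) (hX : X.comp Xinv = 1)
    (hAX : ∀ x, A (X x) = X (W x)) (L L' : ℕ → Submodule ℂ K)
    [∀ n, FiniteDimensional ℂ (L n)] [∀ n, FiniteDimensional ℂ (L' n)] (hmono : Monotone L)
    (hdense : ⊤ ≤ (⨆ n, L n).topologicalClosure) (hL : ∀ n, L n ≤ L' n)
    (hW : ∀ n, ∀ x ∈ L n, W x ∈ L' n) {m : ℕ}
    (hm : ∀ n, Module.finrank ℂ (L' n) ≤ Module.finrank ℂ (L n) + m)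
    {ι : Type*} {e : ι → H} (he : Orthonormal ℂ e) (s : Finset ι) :
    ∑ i ∈ s, (‖e i‖ ^ 2 - ‖A (e i)‖ ^ 2) ≤ ‖Xinv‖ ^ 2 * (m * ‖X‖ ^ 2) := by
  have hXX (x : H) : X (Xinv x) = x := by simpa using DFunLike.congr_fun hX x
  have hlim : Filter.Tendsto
      (fun n => ∑ i ∈ s, (‖X ((L n).starProjection (Xinv (e i)))‖ ^ 2 -
        ‖A (X ((L n).starProjection (Xinv (e i))))‖ ^ 2)) Filter.atTop
      (nhds (∑ i ∈ s, (‖e i‖ ^ 2 - ‖A (e i)‖ ^ 2))) := by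
    refine tendsto_finsetSum _ fun i _ => ?_
    have h := (X.continuous.tendsto _).comp
      (starProjection_tendsto_self L hmono (Xinv (e i)) hdense)
    rw [hXX] at h
    exact (h.norm.pow 2).sub (((A.continuous.tendsto _).comp h).norm.pow 2)
  refine le_of_tendsto' hlim fun n => ?_
  obtain ⟨u, hu⟩ := exists_orthonormalBasis_norm_sq_sub_norm_sq (X.comp (L n).subtypeL)
    (A.comp (X.comp (L n).subtypeL))
  simp only [ContinuousLinearMap.comp_apply, Submodule.subtypeL_apply] at hu
  have htr := sum_norm_sq_sub_norm_sq_le X W (hL n) (hW n) (hm n) u.orthonormal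
  simp only [← hAX] at htr
  have hbessel (j) : ∑ i ∈ s, ‖⟪u j, (L n).orthogonalProjectionOnto (Xinv (e i))⟫_ℂ‖ ^ 2 ≤
      ‖Xinv‖ ^ 2 := by
    have h := he.sum_inner_products_le (adjoint Xinv (u j)) (s := s)
    have h₁ : ‖adjoint Xinv (u j)‖ ≤ ‖Xinv‖ := by
      have := (adjoint Xinv).le_opNorm (u j : K)
      rwa [LinearIsometryEquiv.norm_map, Submodule.norm_coe, u.orthonormal.1, mul_one] at this
    have h₂ (i) : ‖⟪u j, (L n).orthogonalProjectionOnto (Xinv (e i))⟫_ℂ‖ =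
        ‖⟪e i, adjoint Xinv (u j)⟫_ℂ‖ := by
      rw [inner_orthogonalProjectionOnto_eq_of_mem_left, ← norm_inner_symm, adjoint_inner_right]
    simp only [h₂]
    exact h.trans (by gcongr)
  calc _ = ∑ i ∈ s, ∑ j, (‖X (u j)‖ ^ 2 - ‖A (X (u j))‖ ^ 2) *
          ‖⟪u j, (L n).orthogonalProjectionOnto (Xinv (e i))⟫_ℂ‖ ^ 2 :=
        Finset.sum_congr rfl fun i _ => hu _
    _ = ∑ j, (‖X (u j)‖ ^ 2 - ‖A (X (u j))‖ ^ 2) *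
          ∑ i ∈ s, ‖⟪u j, (L n).orthogonalProjectionOnto (Xinv (e i))⟫_ℂ‖ ^ 2 := by
        rw [Finset.sum_comm]
        simp only [Finset.mul_sum]
    _ ≤ ∑ j, (‖X (u j)‖ ^ 2 - ‖A (X (u j))‖ ^ 2) * ‖Xinv‖ ^ 2 := by
        refine Finset.sum_le_sum fun j _ => mul_le_mul_of_nonneg_left (hbessel j) ?_
        rw [sub_nonneg]
        gcongr
        exact hA _
    _ = ‖Xinv‖ ^ 2 * ∑ j, (‖X (u j)‖ ^ 2 - ‖A (X (u j))‖ ^ 2) := by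
        rw [← Finset.sum_mul, mul_comm]
    _ ≤ _ := by gcongr

end Trace

section Krylov

variable {K : Type*} [NormedAddCommGroup K] [InnerProductSpace ℂ K]

/-- The span of the vectors `V ^ k x` with `k < n` and `x ∈ E`. -/
def krylov (V : K →L[ℂ] K) (E : Set K) : ℕ → Submodule ℂ K
  | 0 => ⊥
  | n + 1 => (krylov V E n).map (V : K →ₗ[ℂ] K) ⊔ span ℂ E

theorem krylov_le_succ (V : K →L[ℂ] K) (E : Set K) (n : ℕ) :
    krylov V E n ≤ krylov V E (n + 1) := by
  induction n with
  | zero => exact bot_le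
  | succ n ih => exact sup_le_sup_right (Submodule.map_mono ih) _

theorem apply_mem_krylov_succ {V : K →L[ℂ] K} {E : Set K} {n : ℕ} {x : K}
    (hx : x ∈ krylov V E n) : V x ∈ krylov V E (n + 1) :=
  le_sup_left (a := (krylov V E n).map (V : K →ₗ[ℂ] K)) ⟨x, hx, rfl⟩

theorem pow_apply_mem_krylov (V : K →L[ℂ] K) {E : Set K} {x : K} (hx : x ∈ E) (n : ℕ) :
    (V ^ n) x ∈ krylov V E (n + 1) := by
  induction n with
  | zero => exact le_sup_right (a := (krylov V E 0).map (V : K →ₗ[ℂ] K)) (subset_span hx)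
  | succ n ih =>
    rw [pow_succ']
    exact apply_mem_krylov_succ ih

theorem finiteDimensional_krylov (V : K →L[ℂ] K) {E : Set K} (hE : E.Finite) (n : ℕ) :
    FiniteDimensional ℂ (krylov V E n) := by
  induction n with
  | zero => exact inferInstanceAs (FiniteDimensional ℂ (⊥ : Submodule ℂ K))
  | succ n ih =>
    have := FiniteDimensional.span_of_finite ℂ hE
    exact inferInstanceAs (FiniteDimensional ℂ
      ((krylov V E n).map (V : K →ₗ[ℂ] K) ⊔ span ℂ E : Submodule ℂ K))

theorem finrank_krylov_succ_le (V : K →L[ℂ] K) {E : Set K} (hE : E.Finite) (n : ℕ) :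
    Module.finrank ℂ (krylov V E (n + 1)) ≤
      Module.finrank ℂ (krylov V E n) + Module.finrank ℂ (span ℂ E) := by
  have := finiteDimensional_krylov V hE n
  have := FiniteDimensional.span_of_finite ℂ hE
  exact (Submodule.finrank_add_le_finrank_add_finrank _ _).trans
    (Nat.add_le_add_right (Submodule.finrank_map_le _ _) _)

theorem topologicalClosure_iSup_krylov {V : K →L[ℂ] K} {E : Set K}
    (h : closure (span ℂ (⋃ n : ℕ, (V ^ n) '' E) : Set K) = Set.univ) :
    (⨆ n, krylov V E n).topologicalClosure = ⊤ := by
  have hle : span ℂ (⋃ n : ℕ, (V ^ n) '' E) ≤ ⨆ n, krylov V E n := by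
    refine span_le.2 (Set.iUnion_subset fun n => ?_)
    rintro _ ⟨x, hx, rfl⟩
    exact le_iSup (krylov V E) (n + 1) (pow_apply_mem_krylov V hx n)
  refine SetLike.coe_injective (Set.univ_subset_iff.1 ?_)
  rw [← h]
  exact closure_mono hle

end Krylov

section Moebius

variable {H K : Type*} [NormedAddCommGroup H] [InnerProductSpace ℂ H]
  [NormedAddCommGroup K] [InnerProductSpace ℂ K]

theorem norm_sub_conj_smul_sq_sub (l : ℂ) (x y : H) :
    ‖x - conj l • y‖ ^ 2 - ‖y - l • x‖ ^ 2 = (1 - ‖l‖ ^ 2) * (‖x‖ ^ 2 - ‖y‖ ^ 2) := by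
  rw [@norm_sub_sq ℂ, @norm_sub_sq ℂ, inner_smul_right, inner_smul_right, norm_smul, norm_smul,
    RCLike.norm_conj, ← inner_conj_symm x y, ← map_mul, RCLike.conj_re]
  ring

variable [CompleteSpace H] [CompleteSpace K]

theorem isUnit_one_sub_conj_smul {T : H →L[ℂ] H} (hT : ‖T‖ ≤ 1) {l : ℂ} (hl : ‖l‖ < 1) :
    IsUnit (1 - conj l • T) := by
  refine isUnit_one_sub_of_norm_lt_one ?_
  rw [norm_smul, RCLike.norm_conj]
  exact (mul_le_of_le_one_right (norm_nonneg _) hT).trans_lt hl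

theorem surjective_one_sub_conj_smul {T : H →L[ℂ] H} (hT : ‖T‖ ≤ 1) {l : ℂ} (hl : ‖l‖ < 1) :
    Function.Surjective ((1 : H →L[ℂ] H) - conj l • T) := fun x =>
  ⟨Ring.inverse (1 - conj l • T) x, by
    rw [← mul_apply_eq_comp,
      Ring.mul_inverse_cancel _ (isUnit_one_sub_conj_smul hT hl), one_apply_eq_self]⟩

theorem injective_one_sub_conj_smul {T : H →L[ℂ] H} (hT : ‖T‖ ≤ 1) {l : ℂ} (hl : ‖l‖ < 1) :
    Function.Injective ((1 : H →L[ℂ] H) - conj l • T) :=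
  Function.LeftInverse.injective
    (g := (Ring.inverse (1 - conj l • T) : H →L[ℂ] H)) fun x => by
    rw [← mul_apply_eq_comp,
      Ring.inverse_mul_cancel _ (isUnit_one_sub_conj_smul hT hl), one_apply_eq_self]

theorem blam_apply_one_sub {T : H →L[ℂ] H} (hT : ‖T‖ ≤ 1) {l : ℂ} (hl : ‖l‖ < 1) (x : H) :
    blam T l ((1 - conj l • T) x) = T x - l • x := by
  rw [← mul_apply_eq_comp, blam, mul_assoc,
    Ring.inverse_mul_cancel _ (isUnit_one_sub_conj_smul hT hl)]
  simp

theorem norm_blam_apply_le {T : H →L[ℂ] H} (hT : ‖T‖ ≤ 1) {l : ℂ} (hl : ‖l‖ < 1) (x : H) :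
    ‖blam T l x‖ ≤ ‖x‖ := by
  obtain ⟨y, rfl⟩ := surjective_one_sub_conj_smul hT hl x
  rw [blam_apply_one_sub hT hl]
  have h := norm_sub_conj_smul_sq_sub l y (T y)
  have h₁ : ‖T y‖ ≤ ‖y‖ := T.le_of_opNorm_le_of_le hT le_rfl |>.trans_eq (one_mul _)
  have h₂ : 0 ≤ (1 - ‖l‖ ^ 2) * (‖y‖ ^ 2 - ‖T y‖ ^ 2) := by
    refine mul_nonneg (sub_nonneg.2 (pow_le_one₀ (norm_nonneg _) hl.le)) (sub_nonneg.2 ?_)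
    gcongr
  refine le_of_sq_le_sq ?_ (norm_nonneg _)
  simp only [_root_.sub_apply, one_apply_eq_self,
    _root_.smul_apply]
  linarith

theorem norm_blam_apply_of_isometry {V : K →L[ℂ] K} (hV : ∀ x, ‖V x‖ = ‖x‖) {l : ℂ}
    (hl : ‖l‖ < 1) (x : K) : ‖blam V l x‖ = ‖x‖ := by
  have hV1 : ‖V‖ ≤ 1 := opNorm_le_bound _ zero_le_one fun x => by simp [hV]
  obtain ⟨y, rfl⟩ := surjective_one_sub_conj_smul hV1 hl x
  rw [blam_apply_one_sub hV1 hl]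
  have h := norm_sub_conj_smul_sq_sub l y (V y)
  rw [hV, sub_self, mul_zero, sub_eq_zero] at h
  exact ((sq_eq_sq₀ (norm_nonneg _) (norm_nonneg _)).1 h).symm

theorem blam_apply_intertwine {T : H →L[ℂ] H} (hT : ‖T‖ ≤ 1) {V : K →L[ℂ] K} (hV : ‖V‖ ≤ 1)
    {X : K →L[ℂ] H} (h : X.comp V = T.comp X) {l : ℂ} (hl : ‖l‖ < 1) (x : K) :
    blam T l (X x) = X (blam V l x) := by
  have hx (y : K) : X (V y) = T (X y) := DFunLike.congr_fun h y
  obtain ⟨y, rfl⟩ := surjective_one_sub_conj_smul hV hl x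
  have : X ((1 - conj l • V) y) = (1 - conj l • T) (X y) := by simp [hx]
  rw [this, blam_apply_one_sub hT hl, blam_apply_one_sub hV hl, map_sub, map_smul, hx]

theorem re_inner_one_sub_adjoint_comp_self (A : H →L[ℂ] H) (x : H) :
    (⟪((1 : H →L[ℂ] H) - (adjoint A).comp A) x, x⟫_ℂ).re = ‖x‖ ^ 2 - ‖A x‖ ^ 2 := by
  rw [_root_.sub_apply, inner_sub_left, ContinuousLinearMap.comp_apply,
    adjoint_inner_left, Complex.sub_re, one_apply_eq_self]
  exact congrArg₂ _ (inner_self_eq_norm_sq (𝕜 := ℂ) x) (inner_self_eq_norm_sq (𝕜 := ℂ) (A x))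

end Moebius

/-- If a contraction `T` on a Hilbert space `H` is similar to an isometry `V` of
finite multiplicity (i.e. `V` has a finite generating set), then
`sup_{λ ∈ 𝔻} ‖I - b_λ(T)* b_λ(T)‖_{S₁} < ∞`: there is a uniform bound `C` such that
for every `λ` in the open unit disk the positive operator `I - b_λ(T)* b_λ(T)` is of
trace class with trace norm (its diagonal sum over any orthonormal basis) at most
`C`. -/
theorem sup_traceNorm_blam_defect_lt_top {H K : Type*} [NormedAddCommGroup H]
    [InnerProductSpace ℂ H] [CompleteSpace H] [NormedAddCommGroup K]
    [InnerProductSpace ℂ K] [CompleteSpace K]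
    (T : H →L[ℂ] H) (hT : ‖T‖ ≤ 1) (V : K →L[ℂ] K) (hV : ∀ x : K, ‖V x‖ = ‖x‖)
    (hμ : ∃ E : Set K, E.Finite ∧
      closure (span ℂ (⋃ n : ℕ, (V ^ n) '' E) : Set K) = Set.univ)
    (X : K →L[ℂ] H) (Xinv : H →L[ℂ] K)
    (hX₁ : Xinv.comp X = 1) (hX₂ : X.comp Xinv = 1)
    (hint : X.comp V = T.comp X) :
    ∃ C : ℝ, ∀ l : ℂ, ‖l‖ < 1 →
      ∀ {ι : Type*} (e : HilbertBasis ι ℂ H),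
        Summable (fun i =>
          (⟪((1 : H →L[ℂ] H) - (adjoint (blam T l)).comp (blam T l)) (e i),
            e i⟫_ℂ).re) ∧
        ∑' i, (⟪((1 : H →L[ℂ] H) - (adjoint (blam T l)).comp (blam T l)) (e i),
            e i⟫_ℂ).re ≤ C := by
  obtain ⟨E, hE, hgen⟩ := hμ
  refine ⟨‖Xinv‖ ^ 2 * (Module.finrank ℂ (span ℂ E) * ‖X‖ ^ 2), fun l hl ι e => ?_⟩
  have hV1 : ‖V‖ ≤ 1 := opNorm_le_bound _ zero_le_one fun x => by simp [hV]
  simp only [re_inner_one_sub_adjoint_comp_self]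
  let R : K →L[ℂ] K := 1 - conj l • V
  let L (n : ℕ) : Submodule ℂ K := (krylov V E n).map (R : K →ₗ[ℂ] K)
  have hfin := finiteDimensional_krylov V hE
  have hLL (n : ℕ) : L n ≤ krylov V E (n + 1) := by
    rintro _ ⟨y, hy, rfl⟩
    exact sub_mem (krylov_le_succ V E n hy) (Submodule.smul_mem _ _ (apply_mem_krylov_succ hy))
  have hdense : ⊤ ≤ (⨆ n, L n).topologicalClosure := by
    rw [← Submodule.map_iSup]
    have h : Dense ((⨆ n, krylov V E n : Submodule ℂ K) : Set K) :=
      dense_iff_topologicalClosure_eq_top.2 (topologicalClosure_iSup_krylov hgen)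
    exact (dense_iff_topologicalClosure_eq_top.1
      ((surjective_one_sub_conj_smul hV1 hl).denseRange.dense_image R.continuous h)).ge
  have hbound := sum_norm_sq_sub_norm_sq_le_of_similar (blam T l) (norm_blam_apply_le hT hl)
    ⟨(blam V l : K →ₗ[ℂ] K), norm_blam_apply_of_isometry hV hl⟩ X Xinv hX₂
    (blam_apply_intertwine hT hV1 hint hl) L (fun n => krylov V E (n + 1))
    (monotone_nat_of_le_succ fun n => Submodule.map_mono (krylov_le_succ V E n)) hdense hLL
    (by
      rintro n _ ⟨y, hy, rfl⟩
      have h := blam_apply_one_sub hV1 hl y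
      exact h ▸ sub_mem (apply_mem_krylov_succ hy)
        (Submodule.smul_mem _ _ (krylov_le_succ V E n hy)))
    (fun n => by
      have h : Module.finrank ℂ (L n) = Module.finrank ℂ (krylov V E n) :=
        (Submodule.equivMapOfInjective (R : K →ₗ[ℂ] K)
          (injective_one_sub_conj_smul hV1 hl) _).finrank_eq.symm
      exact h ▸ finrank_krylov_succ_le V hE n)
    e.orthonormal
  have hnonneg : 0 ≤ fun i => ‖e i‖ ^ 2 - ‖blam T l (e i)‖ ^ 2 := fun i =>
    sub_nonneg.2 (pow_le_pow_left₀ (norm_nonneg _) (norm_blam_apply_le hT hl _) 2)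
  exact ⟨summable_of_sum_le hnonneg hbound, Real.tsum_le_of_sum_le hnonneg hbound⟩
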